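/- Let ψ, ψ′ : Fin 2 → Fin 2 → Fin 2 → Fin 2 → ℂ be four-qubit tensors with associated matrices R(ψ) = T ψ̃ T† and R(ψ′) = T ψ̃′ T†. Then there exist A₁, A₂, A₃, A₄ ∈ SL(2,ℂ) with ψ′ = (A₁⊗A₂⊗A₃⊗A₄) ψ if and only if there exist complex special orthogonal matrices O₁, O₂ ∈ SO(4,ℂ) with R(ψ′) = O₁ R(ψ) O₂. Hence two four-qubit pure states are equivalent under determinant-1 SLOCC operations exactly when their R-matrices lie in the same SO(4,ℂ)×SO(4,ℂ) orbit. -/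

import Mathlib

open Matrix

noncomputable section

/-- The fixed matrix `T = (1/√2)·[[1,0,0,1],[0,i,i,0],[0,-1,1,0],[i,0,0,-i]]`. -/
noncomputable def Tmat : Matrix (Fin 4) (Fin 4) ℂ :=
  ((1 / Real.sqrt 2 : ℝ) : ℂ) •
    !![1, 0, 0, 1;
       0, Complex.I, Complex.I, 0;
       0, -1, 1, 0;
       Complex.I, 0, 0, -Complex.I]

/-- The index identification `(i,j) ↦ 2i+j` between `Fin 2 × Fin 2` (ordered 00,01,10,11)
and `Fin 4`. -/
def qIdx : Fin 2 × Fin 2 ≃ Fin 4 where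
  toFun p := ⟨2 * p.1.val + p.2.val, by have h1 := p.1.isLt; have h2 := p.2.isLt; omega⟩
  invFun k := (⟨k.val / 2, by have := k.isLt; omega⟩, ⟨k.val % 2, by have := k.isLt; omega⟩)
  left_inv := by decide
  right_inv := by decide

/-- Kronecker product of two `2×2` matrices as a `4×4` matrix (basis ordered 00,01,10,11). -/
def kron (A B : Matrix (Fin 2) (Fin 2) ℂ) : Matrix (Fin 4) (Fin 4) ℂ :=
  fun r c => A (qIdx.symm r).1 (qIdx.symm c).1 * B (qIdx.symm r).2 (qIdx.symm c).2

/-- The reshaping `ψ̃` of a four-qubit tensor into a `4×4` matrix, with row index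
`(i₁,i₂)` and column index `(i₃,i₄)`, bases ordered 00,01,10,11. -/
def reshape (ψ : Fin 2 → Fin 2 → Fin 2 → Fin 2 → ℂ) : Matrix (Fin 4) (Fin 4) ℂ :=
  fun r c => ψ (qIdx.symm r).1 (qIdx.symm r).2 (qIdx.symm c).1 (qIdx.symm c).2

/-- The matrix `R(ψ) = T ψ̃ T†`. -/
noncomputable def Rmat (ψ : Fin 2 → Fin 2 → Fin 2 → Fin 2 → ℂ) : Matrix (Fin 4) (Fin 4) ℂ :=
  Tmat * reshape ψ * Tmatᴴ

/-- The action of `A₁ ⊗ A₂ ⊗ A₃ ⊗ A₄` on a four-qubit tensor. -/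
def act (A₁ A₂ A₃ A₄ : Matrix (Fin 2) (Fin 2) ℂ) (ψ : Fin 2 → Fin 2 → Fin 2 → Fin 2 → ℂ) :
    Fin 2 → Fin 2 → Fin 2 → Fin 2 → ℂ :=
  fun i₁ i₂ i₃ i₄ => ∑ j₁, ∑ j₂, ∑ j₃, ∑ j₄,
    A₁ i₁ j₁ * A₂ i₂ j₂ * A₃ i₃ j₃ * A₄ i₄ j₄ * ψ j₁ j₂ j₃ j₄

/-- The matrix of the bilinear form polarizing the determinant of `2×2` matrices, flattened along
`qIdx`. -/
def detForm : Matrix (Fin 4) (Fin 4) ℂ :=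
  !![0, 0, 0, 1; 0, 0, -1, 0; 0, -1, 0, 0; 1, 0, 0, 0]

lemma Tmat_coeff_sq : ((1 / Real.sqrt 2 : ℝ) : ℂ) * ((1 / Real.sqrt 2 : ℝ) : ℂ) = 1 / 2 := by
  rw [← Complex.ofReal_mul, div_mul_div_comm, Real.mul_self_sqrt (by norm_num)]
  norm_num

lemma Tmat_mul_conjTranspose : Tmat * Tmatᴴ = 1 := by
  rw [Tmat, conjTranspose_smul, smul_mul_smul_comm, Complex.star_def, Complex.conj_ofReal,
    Tmat_coeff_sq]
  ext i j
  fin_cases i <;> fin_cases j <;>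
    simp [Matrix.mul_apply, Fin.sum_univ_four, conjTranspose_apply, -cons_mul] <;> norm_num

lemma Tmat_conjTranspose_mul : Tmatᴴ * Tmat = 1 :=
  mul_eq_one_comm.mp Tmat_mul_conjTranspose

lemma Tmat_transpose_mul : Tmatᵀ * Tmat = detForm := by
  rw [Tmat, transpose_smul, smul_mul_smul_comm, Tmat_coeff_sq, detForm]
  ext i j
  fin_cases i <;> fin_cases j <;>
    simp [Matrix.mul_apply, Fin.sum_univ_four, transpose_apply] <;> norm_num

lemma kron_eq_submatrix (A B : Matrix (Fin 2) (Fin 2) ℂ) :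
    kron A B = (kroneckerMap (· * ·) A B).submatrix qIdx.symm qIdx.symm := rfl

lemma kron_mul_kron (A B C D : Matrix (Fin 2) (Fin 2) ℂ) :
    kron A B * kron C D = kron (A * C) (B * D) := by
  simp only [kron_eq_submatrix, submatrix_mul_equiv, mul_kronecker_mul]

lemma kron_one_one : kron 1 1 = 1 := by
  rw [kron_eq_submatrix, one_kronecker_one, submatrix_one_equiv]

lemma det_kron (A B : Matrix (Fin 2) (Fin 2) ℂ) : (kron A B).det = A.det ^ 2 * B.det ^ 2 := by
  rw [kron_eq_submatrix, det_submatrix_equiv_self, det_kronecker]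
  simp

lemma kron_transpose (A B : Matrix (Fin 2) (Fin 2) ℂ) : (kron A B)ᵀ = kron Aᵀ Bᵀ := rfl

lemma kron_eq_of (A B : Matrix (Fin 2) (Fin 2) ℂ) :
    kron A B = !![A 0 0 * B 0 0, A 0 0 * B 0 1, A 0 1 * B 0 0, A 0 1 * B 0 1;
      A 0 0 * B 1 0, A 0 0 * B 1 1, A 0 1 * B 1 0, A 0 1 * B 1 1;
      A 1 0 * B 0 0, A 1 0 * B 0 1, A 1 1 * B 0 0, A 1 1 * B 0 1;
      A 1 0 * B 1 0, A 1 0 * B 1 1, A 1 1 * B 1 0, A 1 1 * B 1 1] := by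
  ext i j
  fin_cases i <;> fin_cases j <;> rfl

lemma kron_transpose_mul_detForm_mul (A B : Matrix (Fin 2) (Fin 2) ℂ) :
    (kron A B)ᵀ * detForm * kron A B = (A.det * B.det) • detForm := by
  rw [kron_eq_of, detForm, det_fin_two, det_fin_two]
  ext i j
  fin_cases i <;> fin_cases j <;>
    simp [Matrix.mul_apply, Fin.sum_univ_four, transpose_apply] <;> ring

lemma reshape_injective : Function.Injective reshape := by
  intro ψ φ h
  funext i₁ i₂ i₃ i₄
  simpa [reshape] using congrFun (congrFun h (qIdx (i₁, i₂))) (qIdx (i₃, i₄))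

lemma reshape_act (A₁ A₂ A₃ A₄ : Matrix (Fin 2) (Fin 2) ℂ)
    (ψ : Fin 2 → Fin 2 → Fin 2 → Fin 2 → ℂ) :
    reshape (act A₁ A₂ A₃ A₄ ψ) = kron A₁ A₂ * reshape ψ * (kron A₃ A₄)ᵀ := by
  ext r c
  simp only [Matrix.mul_apply, transpose_apply, ← qIdx.sum_comp, Fintype.sum_prod_type,
    reshape, act, kron, Equiv.symm_apply_apply, Fin.sum_univ_two]
  ring

lemma exists_det_one_col_zero {x y : ℂ} (h : x ≠ 0 ∨ y ≠ 0) :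
    ∃ P : Matrix (Fin 2) (Fin 2) ℂ, P.det = 1 ∧ P 0 0 = x ∧ P 1 0 = y := by
  rcases h with h | h
  · exact ⟨!![x, 0; y, x⁻¹], by simp [det_fin_two, h], rfl, rfl⟩
  · exact ⟨!![x, -y⁻¹; y, 0], by simp [det_fin_two, h], rfl, rfl⟩

lemma exists_kron_col_zero {x : Fin 4 → ℂ} (hx : x ≠ 0) (h : x 0 * x 3 = x 1 * x 2) :
    ∃ P Q : Matrix (Fin 2) (Fin 2) ℂ, P.det = 1 ∧ Q.det = 1 ∧ (kron P Q).col 0 = x := by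
  obtain ⟨a, b, c, d, hab, hcd, h0, h1, h2, h3⟩ : ∃ a b c d : ℂ, (a ≠ 0 ∨ b ≠ 0) ∧
      (c ≠ 0 ∨ d ≠ 0) ∧ a * c = x 0 ∧ a * d = x 1 ∧ b * c = x 2 ∧ b * d = x 3 := by
    by_cases h0 : x 0 = 0
    · by_cases h1 : x 1 = 0
      · refine ⟨0, 1, x 2, x 3, by simp, ?_, by simp [h0], by simp [h1], by simp, by simp⟩
        by_contra! hc
        refine hx (funext fun i => ?_)
        fin_cases i <;> simp [h0, h1, hc.1, hc.2]
      · have h2 : x 2 = 0 := by simpa [h0, h1] using h.symm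
        exact ⟨1, x 3 / x 1, 0, x 1, by simp, .inr h1, by simp [h0], by simp, by simp [h2],
          by field_simp⟩
    · exact ⟨1, x 2 / x 0, x 0, x 1, by simp, .inl h0, by simp, by simp, by field_simp,
        by field_simp; linear_combination -h⟩
  obtain ⟨P, hP, rfl, rfl⟩ := exists_det_one_col_zero hab
  obtain ⟨Q, hQ, rfl, rfl⟩ := exists_det_one_col_zero hcd
  refine ⟨P, Q, hP, hQ, funext fun i => ?_⟩
  rw [kron_eq_of]
  fin_cases i <;> simp [h0, h1, h2, h3]

/-- An element of the special orthogonal group of `detForm` fixing the first basis vector is a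
Kronecker product of upper triangular matrices. -/
lemma exists_eq_kron_of_col_zero {K : Matrix (Fin 4) (Fin 4) ℂ}
    (hK : Kᵀ * detForm * K = detForm) (hdet : K.det = 1) (hcol : K.col 0 = Pi.single 0 1) :
    ∃ A B : Matrix (Fin 2) (Fin 2) ℂ, A.det = 1 ∧ B.det = 1 ∧ K = kron A B := by
  have c0 : K 0 0 = 1 := by simpa using congrFun hcol 0
  have c1 : K 1 0 = 0 := by simpa using congrFun hcol 1
  have c2 : K 2 0 = 0 := by simpa using congrFun hcol 2
  have c3 : K 3 0 = 0 := by simpa using congrFun hcol 3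
  have entry (i j : Fin 4) : K 0 i * K 3 j - K 1 i * K 2 j - K 2 i * K 1 j + K 3 i * K 0 j =
      detForm i j := by
    rw [← congrFun (congrFun hK i) j]
    simp [Matrix.mul_apply, Fin.sum_univ_four, detForm]
    ring
  have r1 : K 3 1 = 0 := by simpa [c0, c1, c2, c3, detForm] using entry 0 1
  have r2 : K 3 2 = 0 := by simpa [c0, c1, c2, c3, detForm] using entry 0 2
  have r3 : K 3 3 = 1 := by simpa [c0, c1, c2, c3, detForm] using entry 0 3
  have e11 := entry 1 1
  have e12 := entry 1 2
  have e13 := entry 1 3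
  have e22 := entry 2 2
  have e23 := entry 2 3
  have e33 := entry 3 3
  simp [r1, r2, r3, detForm] at e11 e12 e13 e22 e23 e33
  have hd : K 1 1 * K 2 2 - K 1 2 * K 2 1 = 1 := by
    rw [← hdet]
    simp [det_succ_column_zero, Fin.sum_univ_succ, c0, c1, c2, c3, Fin.succAbove, r1, r2, r3]
    ring
  have hp : K 1 1 * K 2 2 = 1 := by linear_combination (hd - e12) / 2
  have hp1 : K 1 1 ≠ 0 := left_ne_zero_of_mul_eq_one hp
  have hp2 : K 2 2 ≠ 0 := right_ne_zero_of_mul_eq_one hp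
  have z21 : K 2 1 = 0 := by
    refine (mul_eq_zero.mp ?_).resolve_left hp1
    linear_combination -e11 / 2
  have z12 : K 1 2 = 0 := by
    refine (mul_eq_zero.mp ?_).resolve_right hp2
    linear_combination -e22 / 2
  simp only [z12, z21] at e13 e23
  have h13 : K 1 3 = K 1 1 * K 0 2 := by linear_combination -K 1 1 * e23 - K 1 3 * hp
  have h23 : K 2 3 = K 2 2 * K 0 1 := by linear_combination -K 2 2 * e13 - K 2 3 * hp
  have h03 : K 0 3 = K 0 1 * K 0 2 := by
    rw [h13, h23] at e33
    linear_combination e33 / 2 + K 0 1 * K 0 2 * hp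
  obtain ⟨α, hα⟩ := IsAlgClosed.exists_pow_nat_eq (K 1 1) two_pos
  have hα0 : α ≠ 0 := by rintro rfl; exact hp1 (by simpa using hα.symm)
  have h22 : K 2 2 = α⁻¹ * α⁻¹ := by
    rw [← hα] at hp
    field_simp
    linear_combination hp
  refine ⟨!![α, α * K 0 2; 0, α⁻¹], !![α⁻¹, α⁻¹ * K 0 1; 0, α], by simp [det_fin_two, hα0],
    by simp [det_fin_two, hα0], ?_⟩
  rw [kron_eq_of]
  ext i j
  fin_cases i <;> fin_cases j <;>
    simp [c0, c1, c2, c3, r1, r2, r3, z12, z21, h03, h13, h23, h22, ← hα] <;> field_simp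

/-- The special orthogonal group of `detForm` is the image of `SL(2) × SL(2)` under `kron`. -/
lemma exists_eq_kron {K : Matrix (Fin 4) (Fin 4) ℂ}
    (hK : Kᵀ * detForm * K = detForm) (hdet : K.det = 1) :
    ∃ A B : Matrix (Fin 2) (Fin 2) ℂ, A.det = 1 ∧ B.det = 1 ∧ K = kron A B := by
  have hne : K.col 0 ≠ 0 := fun h => by
    have : K.det = 0 := det_eq_zero_of_column_eq_zero 0 fun i => congrFun h i
    simp [hdet] at this
  have hiso : K.col 0 0 * K.col 0 3 = K.col 0 1 * K.col 0 2 := by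
    have h := congrFun (congrFun hK 0) 0
    simp [Matrix.mul_apply, Fin.sum_univ_four, detForm] at h
    simp only [col_apply]
    linear_combination h / 2
  obtain ⟨P, Q, hP, hQ, hPQ⟩ := exists_kron_col_zero hne hiso
  have hPQK : kron P Q * (kron P⁻¹ Q⁻¹ * K) = K := by
    rw [← Matrix.mul_assoc, kron_mul_kron, mul_nonsing_inv _ (by simp [hP]),
      mul_nonsing_inv _ (by simp [hQ]), kron_one_one, Matrix.one_mul]
  obtain ⟨A, B, hA, hB, h⟩ := exists_eq_kron_of_col_zero (K := kron P⁻¹ Q⁻¹ * K) (by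
      rw [transpose_mul, show Kᵀ * (kron P⁻¹ Q⁻¹)ᵀ * detForm * (kron P⁻¹ Q⁻¹ * K) =
        Kᵀ * ((kron P⁻¹ Q⁻¹)ᵀ * detForm * kron P⁻¹ Q⁻¹) * K by simp only [Matrix.mul_assoc],
        kron_transpose_mul_detForm_mul]
      simp [det_nonsing_inv, hP, hQ, hK])
    (by simp [det_kron, det_nonsing_inv, hP, hQ, hdet]) (by
      rw [← mulVec_single_one, ← mulVec_mulVec, mulVec_single_one, ← hPQ, ← mulVec_single_one,
        mulVec_mulVec, kron_mul_kron, nonsing_inv_mul _ (by simp [hP]),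
        nonsing_inv_mul _ (by simp [hQ]), kron_one_one, one_mulVec])
  exact ⟨P * A, Q * B, by simp [hP, hA], by simp [hQ, hB], by rw [← hPQK, h, kron_mul_kron]⟩

lemma Tmat_conj_kron_mem_SO {A B : Matrix (Fin 2) (Fin 2) ℂ} (hA : A.det = 1) (hB : B.det = 1) :
    (Tmat * kron A B * Tmatᴴ)ᵀ * (Tmat * kron A B * Tmatᴴ) = 1 ∧
      (Tmat * kron A B * Tmatᴴ).det = 1 := by
  constructor
  · calc (Tmat * kron A B * Tmatᴴ)ᵀ * (Tmat * kron A B * Tmatᴴ)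
        = Tmatᴴᵀ * ((kron A B)ᵀ * (Tmatᵀ * Tmat) * kron A B) * Tmatᴴ := by
          simp only [transpose_mul, Matrix.mul_assoc]
      _ = (Tmat * Tmatᴴ)ᵀ * (Tmat * Tmatᴴ) := by
          rw [Tmat_transpose_mul, kron_transpose_mul_detForm_mul, hA, hB, ← Tmat_transpose_mul]
          simp only [mul_one, one_smul, transpose_mul, Matrix.mul_assoc]
      _ = 1 := by simp [Tmat_mul_conjTranspose]
  · rw [det_mul_right_comm, Tmat_mul_conjTranspose, Matrix.one_mul, det_kron, hA, hB]
    norm_num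

lemma exists_Tmat_conj_eq_kron {O : Matrix (Fin 4) (Fin 4) ℂ} (hO : Oᵀ * O = 1)
    (hdet : O.det = 1) :
    ∃ A B : Matrix (Fin 2) (Fin 2) ℂ, A.det = 1 ∧ B.det = 1 ∧ Tmatᴴ * O * Tmat = kron A B := by
  apply exists_eq_kron
  · calc (Tmatᴴ * O * Tmat)ᵀ * detForm * (Tmatᴴ * O * Tmat)
        = Tmatᵀ * (Oᵀ * ((Tmat * Tmatᴴ)ᵀ * (Tmat * Tmatᴴ)) * O) * Tmat := by
          simp only [← Tmat_transpose_mul, transpose_mul, Matrix.mul_assoc]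
      _ = detForm := by simp [Tmat_mul_conjTranspose, hO, Tmat_transpose_mul]
  · rw [det_mul_right_comm, Tmat_conjTranspose_mul, Matrix.one_mul, hdet]

/-- Two four-qubit states are related by determinant-1 SLOCC operations if and only if
their `R`-matrices lie in the same `SO(4,ℂ)×SO(4,ℂ)` orbit. -/
theorem slocc_iff_so4_complex_orbit (ψ ψ' : Fin 2 → Fin 2 → Fin 2 → Fin 2 → ℂ) :
    (∃ A₁ A₂ A₃ A₄ : Matrix (Fin 2) (Fin 2) ℂ,
      A₁.det = 1 ∧ A₂.det = 1 ∧ A₃.det = 1 ∧ A₄.det = 1 ∧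
      ψ' = act A₁ A₂ A₃ A₄ ψ) ↔
    (∃ O₁ O₂ : Matrix (Fin 4) (Fin 4) ℂ,
      O₁ᵀ * O₁ = 1 ∧ O₂ᵀ * O₂ = 1 ∧ O₁.det = 1 ∧ O₂.det = 1 ∧
      Rmat ψ' = O₁ * Rmat ψ * O₂) := by
  constructor
  · rintro ⟨A₁, A₂, A₃, A₄, h₁, h₂, h₃, h₄, rfl⟩
    obtain ⟨hO₁, hd₁⟩ := Tmat_conj_kron_mem_SO h₁ h₂
    obtain ⟨hO₂, hd₂⟩ := Tmat_conj_kron_mem_SO (A := A₃ᵀ) (B := A₄ᵀ)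
      (by rwa [det_transpose]) (by rwa [det_transpose])
    refine ⟨_, _, hO₁, hO₂, hd₁, hd₂, ?_⟩
    calc Rmat (act A₁ A₂ A₃ A₄ ψ)
        = Tmat * kron A₁ A₂ * 1 * reshape ψ * 1 * kron A₃ᵀ A₄ᵀ * Tmatᴴ := by
          simp only [Rmat, reshape_act, kron_transpose, Matrix.mul_one, Matrix.mul_assoc]
      _ = _ := by
          simp only [← Tmat_conjTranspose_mul, Rmat, Matrix.mul_assoc]
  · rintro ⟨O₁, O₂, hO₁, hO₂, hd₁, hd₂, h⟩
    obtain ⟨A₁, A₂, h₁, h₂, hA⟩ := exists_Tmat_conj_eq_kron hO₁ hd₁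
    obtain ⟨A₃, A₄, h₃, h₄, hB⟩ := exists_Tmat_conj_eq_kron hO₂ hd₂
    refine ⟨A₁, A₂, A₃ᵀ, A₄ᵀ, h₁, h₂, by rwa [det_transpose], by rwa [det_transpose],
      reshape_injective ?_⟩
    calc reshape ψ' = (Tmatᴴ * Tmat) * reshape ψ' * (Tmatᴴ * Tmat) := by
          simp [Tmat_conjTranspose_mul]
      _ = Tmatᴴ * Rmat ψ' * Tmat := by simp only [Rmat, Matrix.mul_assoc]
      _ = (Tmatᴴ * O₁ * Tmat) * reshape ψ * (Tmatᴴ * O₂ * Tmat) := by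
          rw [h]; simp only [Rmat, Matrix.mul_assoc]
      _ = reshape (act A₁ A₂ A₃ᵀ A₄ᵀ ψ) := by
          rw [hA, hB, reshape_act, kron_transpose, transpose_transpose, transpose_transpose]
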